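/- Every finite simple graph of tree-width at most 2 satisfies χ⃗(G) ≤ 10. -/

import Mathlib

open SimpleGraph Finset

/-- An orientation of a simple graph `G`: each edge gets exactly one direction. -/
structure GOrientation {V : Type*} (G : SimpleGraph V) where
  dir : V → V → Bool
  adj_iff : ∀ u v, G.Adj u v ↔ (dir u v = true ∨ dir v u = true)
  not_both : ∀ u v, ¬(dir u v = true ∧ dir v u = true)

def GOrientation.outDeg {V : Type*} [Fintype V] {G : SimpleGraph V}
    (o : GOrientation G) (u : V) : ℕ :=
  (Finset.univ.filter fun v => o.dir u v = true).card

def GOrientation.inDeg {V : Type*} [Fintype V] {G : SimpleGraph V}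
    (o : GOrientation G) (u : V) : ℕ :=
  (Finset.univ.filter fun v => o.dir v u = true).card

/-- A proper orientation: adjacent vertices get distinct outdegrees. -/
def GOrientation.IsProper {V : Type*} [Fintype V] {G : SimpleGraph V}
    (o : GOrientation G) : Prop :=
  ∀ u v, G.Adj u v → o.outDeg u ≠ o.outDeg v

/-- Maximum average degree: sup over nonempty subgraphs of 2|E(H)|/|V(H)|. -/
noncomputable def mad {V : Type*} [Fintype V] (G : SimpleGraph V) : ℝ :=
  sSup {x : ℝ | ∃ H : G.Subgraph, H.verts.Nonempty ∧
    x = 2 * H.edgeSet.ncard / H.verts.ncard}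

/-- `H` is a minor of `G`: disjoint nonempty connected branch sets with edges realized. -/
def HasMinor {V W : Type*} (G : SimpleGraph V) (H : SimpleGraph W) : Prop :=
  ∃ B : W → Set V,
    (∀ w, (B w).Nonempty) ∧
    (∀ w, (G.induce (B w)).Connected) ∧
    (∀ w₁ w₂, w₁ ≠ w₂ → Disjoint (B w₁) (B w₂)) ∧
    (∀ w₁ w₂, H.Adj w₁ w₂ → ∃ u ∈ B w₁, ∃ v ∈ B w₂, G.Adj u v)

/-- Planarity via Wagner's theorem: no `K₅` and no `K_{3,3}` minor. -/
def IsPlanar {V : Type*} (G : SimpleGraph V) : Prop :=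
  ¬ HasMinor G (completeGraph (Fin 5)) ∧
  ¬ HasMinor G (completeBipartiteGraph (Fin 3) (Fin 3))

/-- Outerplanarity: no `K₄` and no `K_{2,3}` minor. -/
def IsOuterplanar {V : Type*} (G : SimpleGraph V) : Prop :=
  ¬ HasMinor G (completeGraph (Fin 4)) ∧
  ¬ HasMinor G (completeBipartiteGraph (Fin 2) (Fin 3))



section Helpers

/-- `f 0, …, f n` is a path of `G` inside `R`. -/
def IsP {V : Type*} (G : SimpleGraph V) (R : Finset V) (f : ℕ → V) (n : ℕ) : Prop :=
  (∀ k, k ≤ n → f k ∈ R) ∧ (∀ k l, k ≤ n → l ≤ n → f k = f l → k = l) ∧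
    ∀ k, k < n → G.Adj (f k) (f (k + 1))

lemma seg_connected {V : Type*} (G : SimpleGraph V) (R : Finset V) (f : ℕ → V) (n : ℕ)
    (hf : IsP G R f n) (a b : ℕ) (hab : a ≤ b) (hb : b ≤ n) :
    (G.induce (f '' Set.Icc a b)).Connected := by
  have key : ∀ k, ∀ (h : k ∈ Set.Icc a b),
      (G.induce (f '' Set.Icc a b)).Reachable ⟨f a, a, ⟨le_refl _, hab⟩, rfl⟩ ⟨f k, k, h, rfl⟩ := by
    intro k
    induction k with
    | zero =>
      intro h
      have : a = 0 := by have := h.1; omega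
      subst this
      exact Reachable.refl _
    | succ k ih =>
      intro h
      by_cases hk : a = k + 1
      · subst hk; exact Reachable.refl _
      · have h1 := h.1
        have h2 := h.2
        have hk' : k ∈ Set.Icc a b := ⟨by omega, by omega⟩
        refine (ih hk').trans (Adj.reachable ?_)
        simpa using hf.2.2 k (by omega)
  haveI : Nonempty (f '' Set.Icc a b) := ⟨⟨f a, a, ⟨le_refl _, hab⟩, rfl⟩⟩
  refine ⟨?_⟩
  rintro ⟨x, k, hk, rfl⟩ ⟨y, l, hl, rfl⟩
  exact (key k hk).symm.trans (key l hl)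

lemma seg_disjoint {V : Type*} (G : SimpleGraph V) (R : Finset V) (f : ℕ → V) (n : ℕ)
    (hf : IsP G R f n) (a b c d : ℕ) (h1 : b < c) (h2 : b ≤ n) (h3 : d ≤ n) :
    Disjoint (f '' Set.Icc a b) (f '' Set.Icc c d) := by
  rw [Set.disjoint_left]
  rintro _ ⟨k, hk, rfl⟩ ⟨l, hl, hkl⟩
  have := hf.2.1 l k (hl.2.trans h3) (hk.2.trans h2) hkl
  have := hk.2
  have := hl.1
  omega

lemma four_segments {V : Type*} (G : SimpleGraph V) (R : Finset V) (f : ℕ → V) (n : ℕ)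
    (hf : IsP G R f n) (i x y j m : ℕ) (hi : 2 ≤ i) (hx : i < x) (hy : x ≤ y) (hyn : y ≤ n)
    (h0i : G.Adj (f 0) (f i)) (hj : x ≤ j) (hj' : j ≤ y) (h0j : G.Adj (f 0) (f j))
    (hm : x ≤ m) (hm' : m ≤ y) (him : G.Adj (f (i - 1)) (f m)) :
    HasMinor G (completeGraph (Fin 4)) := by
  let lo : Fin 4 → ℕ := ![0, 1, i, x]
  let hh : Fin 4 → ℕ := ![0, i - 1, x - 1, y]
  have hle : ∀ w, lo w ≤ hh w := by
    intro w; fin_cases w <;> simp [lo, hh] <;> omega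
  have hn : ∀ w, hh w ≤ n := by
    intro w; fin_cases w <;> simp [hh] <;> omega
  have hlt : ∀ w₁ w₂, w₁ < w₂ → hh w₁ < lo w₂ := by
    intro w₁ w₂ h
    fin_cases w₁ <;> fin_cases w₂ <;> simp [lo, hh] at h ⊢ <;> omega
  have hadj : ∀ w₁ w₂, w₁ < w₂ → ∃ u ∈ f '' Set.Icc (lo w₁) (hh w₁),
      ∃ v ∈ f '' Set.Icc (lo w₂) (hh w₂), G.Adj u v := by
    have mk : ∀ w₁ w₂ a b, lo w₁ ≤ a → a ≤ hh w₁ → lo w₂ ≤ b → b ≤ hh w₂ →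
        G.Adj (f a) (f b) → ∃ u ∈ f '' Set.Icc (lo w₁) (hh w₁),
      ∃ v ∈ f '' Set.Icc (lo w₂) (hh w₂), G.Adj u v := by
      intro w₁ w₂ a b h1 h2 h3 h4 h5
      exact ⟨f a, ⟨a, ⟨h1, h2⟩, rfl⟩, f b, ⟨b, ⟨h3, h4⟩, rfl⟩, h5⟩
    have e1 := hf.2.2 0 (by omega)
    have e2 := hf.2.2 (i - 1) (by omega)
    have e3 := hf.2.2 (x - 1) (by omega)
    rw [show i - 1 + 1 = i by omega] at e2
    rw [show x - 1 + 1 = x by omega] at e3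
    intro w₁ w₂ h
    fin_cases w₁ <;> fin_cases w₂ <;> simp at h
    · exact mk 0 1 0 1 (by simp [lo]) (by simp [hh]) (by simp [lo]) (by simp [hh]; omega) e1
    · exact mk 0 2 0 i (by simp [lo]) (by simp [hh]) (by simp [lo]) (by simp [hh]; omega) h0i
    · exact mk 0 3 0 j (by simp [lo]) (by simp [hh]) (by simpa [lo]) (by simpa [hh]) h0j
    · exact mk 1 2 (i - 1) i (by simp [lo]; omega) (by simp [hh]) (by simp [lo])
        (by simp [hh]; omega) e2
    · exact mk 1 3 (i - 1) m (by simp [lo]; omega) (by simp [hh]) (by simpa [lo])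
        (by simpa [hh]) him
    · exact mk 2 3 (x - 1) x (by simp [lo]; omega) (by simp [hh]) (by simp [lo])
        (by simpa [hh]) e3
  refine ⟨fun w => f '' Set.Icc (lo w) (hh w), ?_, ?_, ?_, ?_⟩
  · intro w; exact ⟨f (lo w), lo w, ⟨le_refl _, hle w⟩, rfl⟩
  · intro w; exact seg_connected G R f n hf _ _ (hle w) (hn w)
  · intro w₁ w₂ h
    rcases lt_or_gt_of_ne h with h | h
    · exact seg_disjoint G R f n hf _ _ _ _ (hlt _ _ h) (hn _) (hn _)
    · exact (seg_disjoint G R f n hf _ _ _ _ (hlt _ _ h) (hn _) (hn _)).symm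
  · intro w₁ w₂ h
    have hne : w₁ ≠ w₂ := by simpa using h
    rcases lt_or_gt_of_ne hne with h | h
    · exact hadj _ _ h
    · obtain ⟨u, hu, v, hv, huv⟩ := hadj _ _ h
      exact ⟨v, hv, u, hu, huv.symm⟩

open Classical in
lemma dirac {V : Type*} (G : SimpleGraph V) (R : Finset V) (hne : R.Nonempty)
    (hdeg : ∀ v ∈ R, 3 ≤ (R.filter fun u => G.Adj v u).card) :
    HasMinor G (completeGraph (Fin 4)) := by
  -- a longest path
  have hbound : ∀ n f, IsP G R f n → n ≤ R.card := by
    intro n f hf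
    have : ((Finset.range (n + 1)).image f).card = n + 1 := by
      rw [Finset.card_image_of_injOn, Finset.card_range]
      intro k hk l hl hkl
      simp at hk hl
      exact hf.2.1 k l (by omega) (by omega) hkl
    have h2 : ((Finset.range (n + 1)).image f) ⊆ R := by
      intro v hv
      simp only [Finset.mem_image, Finset.mem_range] at hv
      obtain ⟨k, hk, rfl⟩ := hv
      exact hf.1 k (by omega)
    have := Finset.card_le_card h2
    omega
  obtain ⟨n, ⟨f₀, hf₀⟩, hmax⟩ : ∃ n, (∃ f, IsP G R f n) ∧ ∀ m, (∃ f, IsP G R f m) → m ≤ n := by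
    obtain ⟨r, hr⟩ := hne
    have h0 : ∃ f, IsP G R f 0 :=
      ⟨fun _ => r, fun _ _ => hr, fun k l hk hl _ => by omega, fun k hk => by omega⟩
    refine ⟨Nat.findGreatest (fun m => ∃ f, IsP G R f m) R.card,
      Nat.findGreatest_spec (P := fun m => ∃ f, IsP G R f m) (Nat.zero_le _) h0, ?_⟩
    intro m hm
    obtain ⟨f, hf⟩ := hm
    exact Nat.le_findGreatest (hbound m f hf) ⟨f, hf⟩
  have hlong : ∀ f, IsP G R f n → ∀ u ∈ R, G.Adj (f 0) u → ∃ k, 1 ≤ k ∧ k ≤ n ∧ f k = u := by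
    intro f hf u hu hadj
    by_contra hcon
    push Not at hcon
    have hno : ∀ k, k ≤ n → f k ≠ u := by
      intro k hk
      rcases Nat.eq_zero_or_pos k with h | h
      · subst h; exact hadj.ne
      · exact hcon k h hk
    have hnew : IsP G R (fun k => if k = 0 then u else f (k - 1)) (n + 1) := by
      refine ⟨?_, ?_, ?_⟩
      · intro k hk
        by_cases h : k = 0
        · simp [h, hu]
        · simp only [h, if_false]; exact hf.1 _ (by omega)
      · intro k l hk hl hkl
        by_cases h : k = 0 <;> by_cases h' : l = 0
        · omega
        · simp only [h, h', if_true, if_false] at hkl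
          exact absurd hkl.symm (hno _ (by omega))
        · simp only [h, h', if_true, if_false] at hkl
          exact absurd hkl (hno _ (by omega))
        · simp only [h, h', if_false] at hkl
          have := hf.2.1 _ _ (by omega) (by omega) hkl
          omega
      · intro k hk
        by_cases h : k = 0
        · subst h; simpa using hadj.symm
        · have := hf.2.2 (k - 1) (by omega)
          rw [show k - 1 + 1 = k by omega] at this
          simpa [h] using this
    have := hmax (n + 1) ⟨_, hnew⟩
    omega
  have main : ∀ i, 2 ≤ i → ∀ f, IsP G R f n → ∀ j, i < j → j ≤ n → G.Adj (f 0) (f i) →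
      G.Adj (f 0) (f j) → HasMinor G (completeGraph (Fin 4)) := by
    intro i
    induction i using Nat.strong_induction_on with
    | _ i ih =>
    intro hi f hf j hij hjn h0i h0j
    -- rotated path
    let g : ℕ → V := fun k => if k ≤ i - 1 then f (i - 1 - k) else f k
    have hg1 : ∀ k, k ≤ i - 1 → g k = f (i - 1 - k) := fun k hk => by simp [g, hk]
    have hg2 : ∀ k, i ≤ k → g k = f k := fun k hk => by
      have : ¬ k ≤ i - 1 := by omega
      simp [g, this]
    have hg : IsP G R g n := by
      refine ⟨?_, ?_, ?_⟩
      · intro k hk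
        by_cases h : k ≤ i - 1
        · rw [hg1 k h]; exact hf.1 _ (by omega)
        · rw [hg2 k (by omega)]; exact hf.1 _ (by omega)
      · intro k l hk hl hkl
        by_cases h : k ≤ i - 1 <;> by_cases h' : l ≤ i - 1
        · rw [hg1 k h, hg1 l h'] at hkl
          have := hf.2.1 _ _ (by omega) (by omega) hkl
          omega
        · rw [hg1 k h, hg2 l (by omega)] at hkl
          have := hf.2.1 _ _ (by omega) (by omega) hkl
          omega
        · rw [hg2 k (by omega), hg1 l h'] at hkl
          have := hf.2.1 _ _ (by omega) (by omega) hkl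
          omega
        · rw [hg2 k (by omega), hg2 l (by omega)] at hkl
          have := hf.2.1 _ _ (by omega) (by omega) hkl
          omega
      · intro k hk
        by_cases h : k + 1 ≤ i - 1
        · rw [hg1 k (by omega), hg1 (k + 1) h]
          have := hf.2.2 (i - 1 - (k + 1)) (by omega)
          rw [show i - 1 - (k + 1) + 1 = i - 1 - k by omega] at this
          exact this.symm
        · by_cases h2 : k ≤ i - 1
          · rw [hg1 k h2, hg2 (k + 1) (by omega), show i - 1 - k = 0 by omega,
              show k + 1 = i by omega]
            exact h0i
          · rw [hg2 k (by omega), hg2 (k + 1) (by omega)]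
            exact hf.2.2 k hk
    -- a third neighbour of `f (i-1)`
    have hcard := hdeg (f (i - 1)) (hf.1 _ (by omega))
    obtain ⟨u, hu, hu'⟩ : ∃ u ∈ R.filter (fun u => G.Adj (f (i - 1)) u),
        u ∉ ({f (i - 2), f i} : Finset V) := by
      by_contra hcon
      push Not at hcon
      have h1 := Finset.card_le_card (show _ ⊆ ({f (i - 2), f i} : Finset V) from hcon)
      have h2 := Finset.card_le_two (a := f (i - 2)) (b := f i)
      omega
    simp only [Finset.mem_filter] at hu
    simp only [Finset.mem_insert, Finset.mem_singleton, not_or] at hu'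
    have hg0 : g 0 = f (i - 1) := by rw [hg1 0 (by omega)]; simp
    obtain ⟨k, hk1, hkn, hk⟩ := hlong g hg u hu.1 (by rw [hg0]; exact hu.2)
    by_cases hki : k ≤ i - 1
    · have hk2 : 2 ≤ k := by
        by_contra hlt
        have : k = 1 := by omega
        subst this
        apply hu'.1
        rw [← hk, hg1 1 hki]
        congr 1
      refine ih k (by omega) hk2 g hg i (by omega) (by omega) ?_ ?_
      · rw [hg0, hk]; exact hu.2
      · rw [hg0, hg2 i (le_refl _)]
        have := hf.2.2 (i - 1) (by omega)
        rwa [show i - 1 + 1 = i by omega] at this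
    · have hkk : k ≠ i := by
        rintro rfl
        apply hu'.2
        rw [← hk, hg2 k (le_refl _)]
      have hfk : f k = u := by rw [← hk, hg2 k (by omega)]
      exact four_segments G R f n hf i (min j k) (max j k) j k hi (by omega) (by omega) (by omega)
        h0i (by omega) (by omega) h0j (by omega) (by omega) (by rw [hfk]; exact hu.2)
  -- start
  have hcard := hdeg (f₀ 0) (hf₀.1 0 (by omega))
  obtain ⟨s, hs, hs3⟩ := Finset.exists_subset_card_eq hcard
  obtain ⟨a, b, c, hab, hac, hbc, rfl⟩ := Finset.card_eq_three.mp hs3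
  have hm : ∀ x ∈ ({a, b, c} : Finset V), ∃ k, 1 ≤ k ∧ k ≤ n ∧ f₀ k = x ∧ G.Adj (f₀ 0) x := by
    intro x hx
    have := hs hx
    simp only [Finset.mem_filter] at this
    obtain ⟨k, h1, h2, h3⟩ := hlong f₀ hf₀ x this.1 this.2
    exact ⟨k, h1, h2, h3, this.2⟩
  obtain ⟨ka, a1, a2, a3, a4⟩ := hm a (by simp)
  obtain ⟨kb, b1, b2, b3, b4⟩ := hm b (by simp)
  obtain ⟨kc, c1, c2, c3, c4⟩ := hm c (by simp)
  have nab : ka ≠ kb := by rintro rfl; exact hab (a3.symm.trans b3)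
  have nac : ka ≠ kc := by rintro rfl; exact hac (a3.symm.trans c3)
  have nbc : kb ≠ kc := by rintro rfl; exact hbc (b3.symm.trans c3)
  rw [← a3] at a4
  rw [← b3] at b4
  rw [← c3] at c4
  obtain ⟨i, j, hi, hij, hjn, hai, haj⟩ : ∃ i j, 2 ≤ i ∧ i < j ∧ j ≤ n ∧ G.Adj (f₀ 0) (f₀ i) ∧
      G.Adj (f₀ 0) (f₀ j) := by
    have two : ∀ x y, x ≠ y → 2 ≤ x → 2 ≤ y → x ≤ n → y ≤ n → G.Adj (f₀ 0) (f₀ x) →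
        G.Adj (f₀ 0) (f₀ y) → ∃ i j, 2 ≤ i ∧ i < j ∧ j ≤ n ∧ G.Adj (f₀ 0) (f₀ i) ∧
      G.Adj (f₀ 0) (f₀ j) := by
      intro x y hxy hx hy hxn hyn h1 h2
      rcases lt_or_gt_of_ne hxy with h | h
      · exact ⟨x, y, hx, h, hyn, h1, h2⟩
      · exact ⟨y, x, hy, h, hxn, h2, h1⟩
    by_cases h1 : ka = 1
    · exact two kb kc nbc (by omega) (by omega) b2 c2 b4 c4
    · by_cases h2 : kb = 1
      · exact two ka kc nac (by omega) (by omega) a2 c2 a4 c4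
      · exact two ka kb nab (by omega) (by omega) a2 b2 a4 b4
  exact main i hi f₀ hf₀ j hij hjn hai haj

open Classical in
/-- 2-degeneracy data: a proper 3-colouring and an orientation with outdegree at most 2. -/
lemma degen {V : Type*} (G : SimpleGraph V)
    (hG : ¬ HasMinor G (completeGraph (Fin 4))) (R : Finset V) :
    ∃ (c : V → Fin 3) (o : V → Finset V),
      (∀ u ∈ R, ∀ v ∈ R, G.Adj u v → c u ≠ c v) ∧
      (∀ u ∈ R, ∀ v ∈ R, G.Adj u v → v ∈ o u ∨ u ∈ o v) ∧
      (∀ u v, v ∈ o u → G.Adj u v) ∧ ∀ u, (o u).card ≤ 2 := by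
  induction R using Finset.strongInduction with
  | _ R ih =>
  by_cases hne : R.Nonempty
  · obtain ⟨v, hv, hdeg⟩ : ∃ v ∈ R, (R.filter fun u => G.Adj v u).card ≤ 2 := by
      by_contra hcon
      push Not at hcon
      exact hG (dirac G R hne fun v hv => hcon v hv)
    obtain ⟨c, o, h1, h2, h3, h4⟩ := ih (R.erase v) (Finset.erase_ssubset hv)
    obtain ⟨x, hx⟩ : ∃ x : Fin 3, x ∉ (R.filter fun u => G.Adj v u).image c := by
      by_contra hcon
      push Not at hcon
      have h5 : (Finset.univ : Finset (Fin 3)) ⊆ (R.filter fun u => G.Adj v u).image c :=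
        fun x _ => hcon x
      have h6 := Finset.card_le_card h5
      have h7 := Finset.card_image_le (s := R.filter fun u => G.Adj v u) (f := c)
      simp only [Finset.card_univ, Fintype.card_fin] at h6
      omega
    have hx' : ∀ u ∈ R, G.Adj v u → c u ≠ x := by
      intro u hu hadj h
      exact hx (Finset.mem_image.mpr ⟨u, Finset.mem_filter.mpr ⟨hu, hadj⟩, h⟩)
    refine ⟨Function.update c v x, Function.update o v (R.filter fun u => G.Adj v u),
      ?_, ?_, ?_, ?_⟩
    · intro u hu w hw hadj
      by_cases hu' : u = v
      · subst hu'
        rw [Function.update_self, Function.update_of_ne hadj.ne']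
        exact (hx' w hw hadj).symm
      · by_cases hw' : w = v
        · subst hw'
          rw [Function.update_self, Function.update_of_ne hu']
          exact hx' u hu hadj.symm
        · rw [Function.update_of_ne hu', Function.update_of_ne hw']
          exact h1 u (Finset.mem_erase.mpr ⟨hu', hu⟩) w (Finset.mem_erase.mpr ⟨hw', hw⟩) hadj
    · intro u hu w hw hadj
      by_cases hu' : u = v
      · subst hu'
        left
        rw [Function.update_self]
        exact Finset.mem_filter.mpr ⟨hw, hadj⟩
      · by_cases hw' : w = v
        · subst hw'
          right
          rw [Function.update_self]
          exact Finset.mem_filter.mpr ⟨hu, hadj.symm⟩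
        · rw [Function.update_of_ne hu', Function.update_of_ne hw']
          exact h2 u (Finset.mem_erase.mpr ⟨hu', hu⟩) w (Finset.mem_erase.mpr ⟨hw', hw⟩) hadj
    · intro u w hw
      by_cases hu' : u = v
      · subst hu'
        rw [Function.update_self] at hw
        exact (Finset.mem_filter.mp hw).2
      · rw [Function.update_of_ne hu'] at hw
        exact h3 u w hw
    · intro u
      by_cases hu' : u = v
      · subst hu'
        rw [Function.update_self]; exact hdeg
      · rw [Function.update_of_ne hu']; exact h4 u
  · rw [Finset.not_nonempty_iff_eq_empty] at hne
    subst hne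
    exact ⟨fun _ => 0, fun _ => ∅, by simp, by simp, by simp, by simp⟩


end Helpers

section Orient
open Classical

/-- neighbours of `v` inside `R` -/
noncomputable def nb {V : Type*} (G : SimpleGraph V) (R : Finset V) (v : V) : Finset V :=
  R.filter (fun u => G.Adj v u)

/-- total potential of `v` -/
noncomputable def qq {V : Type*} (G : SimpleGraph V) (R : Finset V) (p : V → ℕ) (v : V) : ℕ :=
  p v + (nb G R v).card

/-- solvability of the partially peeled instance -/
def Sol {V : Type*} (G : SimpleGraph V) (R : Finset V) (p : V → ℕ) (t : ℕ) : Prop :=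
  ∃ d : V → V → Prop, (∀ u ∈ R, ∀ v ∈ R, G.Adj u v → d u v ∨ d v u) ∧
    (∀ u v, d u v → G.Adj u v) ∧ (∀ u v, d u v → ¬ d v u) ∧
    (∀ u ∈ R, p u + (R.filter (fun v => d u v)).card ≤ t) ∧
    (∀ u ∈ R, ∀ v ∈ R, G.Adj u v →
      p u + (R.filter (fun w => d u w)).card ≠ p v + (R.filter (fun w => d v w)).card)

/-- updated demand -/
noncomputable def pnew {V : Type*} (G : SimpleGraph V) (S : Finset V) (own : V → Finset V)
    (p : V → ℕ) (v : V) : ℕ :=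
  p v + (S.filter (fun s => G.Adj v s ∧ v ∉ own s)).card

lemma mem_nb {V : Type*} {G : SimpleGraph V} {R : Finset V} {v u : V} :
    u ∈ nb G R v ↔ u ∈ R ∧ G.Adj v u := by simp [nb]

lemma ext_lemma {V : Type*} (G : SimpleGraph V) (R S : Finset V) (own : V → Finset V)
    (p : V → ℕ) (t : ℕ) (ht : 1 ≤ t) (hSR : S ⊆ R)
    (hind : ∀ u ∈ S, ∀ v ∈ S, ¬ G.Adj u v)
    (hown : ∀ s ∈ S, own s ⊆ nb G R s ∧ p s + (own s).card = t)
    (h : Sol G (R \ S) (pnew G S own p) (t - 1)) : Sol G R p t := by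
  obtain ⟨d, h1, h2, h3, h4, h5⟩ := h
  have hadj : ∀ s ∈ S, ∀ v ∈ own s, v ∈ R ∧ G.Adj s v := fun s hs v hv =>
    mem_nb.1 ((hown s hs).1 hv)
  obtain ⟨D, hD⟩ : ∃ D : V → V → Prop, ∀ u v, D u v ↔ ((u ∈ S ∧ v ∈ own u) ∨
    (u ∉ S ∧ v ∈ S ∧ G.Adj u v ∧ u ∉ own v) ∨ (u ∉ S ∧ v ∉ S ∧ d u v)) :=
    ⟨fun u v => _, fun u v => Iff.rfl⟩
  have hvS : ∀ u ∈ S, p u + (R.filter (fun v => D u v)).card = t := by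
    intro u hu
    have : R.filter (fun v => D u v) = own u := by
      ext v
      simp only [Finset.mem_filter, hD]
      constructor
      · rintro ⟨_, ⟨_, h⟩ | ⟨h, _⟩ | ⟨h, _⟩⟩
        · exact h
        · exact absurd hu h
        · exact absurd hu h
      · intro hv
        exact ⟨(hadj u hu v hv).1, Or.inl ⟨hu, hv⟩⟩
    rw [this]; exact (hown u hu).2
  have hvN : ∀ u, u ∉ S → p u + (R.filter (fun v => D u v)).card =
      pnew G S own p u + ((R \ S).filter (fun v => d u v)).card := by
    intro u hu
    have : R.filter (fun v => D u v) =
        S.filter (fun s => G.Adj u s ∧ u ∉ own s) ∪ (R \ S).filter (fun v => d u v) := by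
      ext v
      simp only [Finset.mem_filter, Finset.mem_union, Finset.mem_sdiff, hD]
      have := @hSR v
      tauto
    rw [this, Finset.card_union_of_disjoint]
    · unfold pnew; omega
    · rw [Finset.disjoint_left]
      intro v hv hv2
      simp only [Finset.mem_filter, Finset.mem_sdiff] at hv hv2
      exact hv2.1.2 hv.1
  refine ⟨D, ?_, ?_, ?_, ?_, ?_⟩
  · intro u hu v hv huv
    rw [hD, hD]
    by_cases hus : u ∈ S <;> by_cases hvs : v ∈ S
    · exact absurd huv (hind u hus v hvs)
    · by_cases ho : v ∈ own u
      · exact Or.inl (Or.inl ⟨hus, ho⟩)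
      · exact Or.inr (Or.inr (Or.inl ⟨hvs, hus, huv.symm, ho⟩))
    · by_cases ho : u ∈ own v
      · exact Or.inr (Or.inl ⟨hvs, ho⟩)
      · exact Or.inl (Or.inr (Or.inl ⟨hus, hvs, huv, ho⟩))
    · rcases h1 u (by simp [hu, hus]) v (by simp [hv, hvs]) huv with h | h
      · exact Or.inl (Or.inr (Or.inr ⟨hus, hvs, h⟩))
      · exact Or.inr (Or.inr (Or.inr ⟨hvs, hus, h⟩))
  · intro u v
    simp only [hD]
    rintro (⟨hu, hv⟩ | ⟨_, _, h, _⟩ | ⟨_, _, h⟩)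
    · exact (hadj u hu v hv).2
    · exact h
    · exact h2 u v h
  · intro u v
    simp only [hD]
    rintro (⟨hu, hv⟩ | ⟨a1, a2, a3, a4⟩ | ⟨a1, a2, a3⟩)
    · rintro (⟨b1, b2⟩ | ⟨b1, b2, b3, b4⟩ | ⟨b1, b2, b3⟩)
      · exact hind u hu v b1 (hadj u hu v hv).2
      · exact b4 hv
      · exact b2 hu
    · rintro (⟨b1, b2⟩ | ⟨b1, b2, b3, b4⟩ | ⟨b1, b2, b3⟩)
      · exact a4 b2
      · exact a1 b2
      · exact b1 a2
    · rintro (⟨b1, b2⟩ | ⟨b1, b2, b3, b4⟩ | ⟨b1, b2, b3⟩)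
      · exact a2 b1
      · exact a1 b2
      · exact h3 u v a3 b3
  · intro u hu
    by_cases hus : u ∈ S
    · exact (hvS u hus).le
    · rw [hvN u hus]
      have := h4 u (by simp [hu, hus])
      omega
  · intro u hu v hv huv
    by_cases hus : u ∈ S <;> by_cases hvs : v ∈ S
    · exact absurd huv (hind u hus v hvs)
    · rw [hvS u hus, hvN v hvs]
      have := h4 v (by simp [hv, hvs])
      omega
    · rw [hvS v hvs, hvN u hus]
      have := h4 u (by simp [hu, hus])
      omega
    · rw [hvN u hus, hvN v hvs]
      exact h5 u (by simp [hu, hus]) v (by simp [hv, hvs]) huv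

lemma qq_new {V : Type*} (G : SimpleGraph V) (R S : Finset V) (own : V → Finset V)
    (p : V → ℕ) (hSR : S ⊆ R) (v : V) :
    qq G (R \ S) (pnew G S own p) v + (S.filter (fun s => G.Adj v s ∧ v ∈ own s)).card
      = qq G R p v := by
  have : nb G R v = nb G (R \ S) v ∪ (S.filter (fun s => G.Adj v s ∧ v ∉ own s) ∪
      S.filter (fun s => G.Adj v s ∧ v ∈ own s)) := by
    ext u
    simp only [nb, Finset.mem_filter, Finset.mem_union, Finset.mem_sdiff]
    have := @hSR u
    tauto
  unfold qq
  rw [this, Finset.card_union_of_disjoint, Finset.card_union_of_disjoint]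
  · unfold pnew; omega
  · rw [Finset.disjoint_left]
    intro a ha hb
    simp only [Finset.mem_filter] at ha hb
    exact ha.2.2 hb.2.2
  · rw [Finset.disjoint_left]
    intro a ha hb
    simp only [nb, Finset.mem_filter, Finset.mem_union, Finset.mem_sdiff] at ha hb
    rcases hb with hb | hb
    · exact ha.1.2 hb.1
    · exact ha.1.2 hb.1

lemma max_indep {V : Type*} (G : SimpleGraph V) (U Y : Finset V) (hYU : Y ⊆ U)
    (hY : ∀ u ∈ Y, ∀ v ∈ Y, ¬ G.Adj u v) :
    ∃ I : Finset V, I ⊆ U ∧ Y ⊆ I ∧ (∀ u ∈ I, ∀ v ∈ I, ¬ G.Adj u v) ∧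
      ∀ b ∈ U, b ∉ I → ∃ i ∈ I, G.Adj b i := by
  obtain ⟨I, hI, hmax⟩ := Finset.exists_max_image
    (U.powerset.filter (fun I => Y ⊆ I ∧ ∀ u ∈ I, ∀ v ∈ I, ¬ G.Adj u v)) Finset.card
    ⟨Y, by simp only [Finset.mem_filter, Finset.mem_powerset]; exact ⟨hYU, subset_rfl, hY⟩⟩
  simp only [Finset.mem_filter, Finset.mem_powerset] at hI hmax
  refine ⟨I, hI.1, hI.2.1, hI.2.2, ?_⟩
  intro b hb hbI
  by_contra hno
  push Not at hno
  have := hmax (insert b I) ⟨Finset.insert_subset hb hI.1,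
    hI.2.1.trans (Finset.subset_insert _ _), ?_⟩
  · rw [Finset.card_insert_of_notMem hbI] at this
    omega
  · intro u hu v hv huv
    rw [Finset.mem_insert] at hu hv
    rcases hu with rfl | hu <;> rcases hv with rfl | hv
    · exact G.loopless.irrefl _ huv
    · exact hno v hv huv
    · exact hno u hu huv.symm
    · exact hI.2.2 u hu v hv huv

lemma max_cov {V : Type*} (G : SimpleGraph V) (R A B : Finset V) (o : V → Finset V)
    (p : V → ℕ) (t : ℕ)
    (hBR : B ⊆ R)
    (ho : ∀ u v, v ∈ o u → G.Adj u v)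
    (hA2 : ∀ a ∈ A, t ≤ qq G R p a) :
    ∃ (C : Finset V) (own : V → Finset V), C ⊆ A ∧
      (∀ a ∈ C, o a ∩ R ⊆ own a ∧ own a ⊆ nb G R a ∧ p a + (own a).card = t) ∧
      (∀ b ∈ B, ∀ a ∈ C, G.Adj a b → ∃ a' ∈ C, b ∈ own a') ∧
      (∀ a ∈ A, a ∉ C → t < p a + (o a ∩ R).card +
        (nb G (B.filter (fun b => ∀ c ∈ C, ¬ G.Adj c b)) a).card) := by
  obtain ⟨C, hC, hmax⟩ := Finset.exists_max_image
    (A.powerset.filter (fun C => ∃ own : V → Finset V,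
      (∀ a ∈ C, o a ∩ R ⊆ own a ∧ own a ⊆ nb G R a ∧ p a + (own a).card = t) ∧
      (∀ b ∈ B, ∀ a ∈ C, G.Adj a b → ∃ a' ∈ C, b ∈ own a'))) Finset.card
    ⟨∅, by simp⟩
  simp only [Finset.mem_filter, Finset.mem_powerset] at hC hmax
  obtain ⟨hCA, own, h1, h2⟩ := hC
  refine ⟨C, own, hCA, h1, h2, ?_⟩
  intro a haA haC
  by_contra hle
  push Not at hle
  set U := B.filter (fun b => ∀ c ∈ C, ¬ G.Adj c b) with hU
  have hsub : nb G U a ∪ (o a ∩ R) ⊆ nb G R a := by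
    intro x hx
    rw [Finset.mem_union, Finset.mem_inter, mem_nb] at hx
    rw [mem_nb]
    rcases hx with hx | hx
    · exact ⟨hBR (Finset.mem_filter.1 hx.1).1, hx.2⟩
    · exact ⟨hx.2, ho _ _ hx.1⟩
  have hq := hA2 a haA
  unfold qq at hq
  obtain ⟨W, hW1, hW2, hW3⟩ := Finset.exists_subsuperset_card_eq (n := t - p a) hsub
    (by have := Finset.card_union_le (nb G U a) (o a ∩ R); omega) (by omega)
  have hne : ∀ x ∈ C, x ≠ a := fun x hx h => haC (h ▸ hx)
  have := hmax (insert a C) ⟨Finset.insert_subset haA hCA, Function.update own a W, ?_, ?_⟩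
  · rw [Finset.card_insert_of_notMem haC] at this
    omega
  · intro x hx
    rw [Finset.mem_insert] at hx
    rcases hx with rfl | hx
    · rw [Function.update_self]
      exact ⟨Finset.subset_union_right.trans hW1, hW2, by omega⟩
    · rw [Function.update_of_ne (hne x hx)]
      exact h1 x hx
  · intro b hb x hx hxb
    have key : (∃ c ∈ C, G.Adj c b) → ∃ a' ∈ insert a C, b ∈ Function.update own a W a' := by
      rintro ⟨c, hc, hcb⟩
      obtain ⟨a', ha', hba'⟩ := h2 b hb c hc hcb
      refine ⟨a', Finset.mem_insert_of_mem ha', ?_⟩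
      rw [Function.update_of_ne (hne a' ha')]
      exact hba'
    by_cases hex : ∃ c ∈ C, G.Adj c b
    · exact key hex
    · rw [Finset.mem_insert] at hx
      rcases hx with rfl | hx
      · refine ⟨x, Finset.mem_insert_self _ _, ?_⟩
        rw [Function.update_self]
        apply hW1
        rw [Finset.mem_union, mem_nb, hU, Finset.mem_filter]
        push Not at hex
        exact Or.inl ⟨⟨hb, hex⟩, hxb⟩
      · exact absurd ⟨x, hx, hxb⟩ hex

lemma level {V : Type*} (G : SimpleGraph V) (R A B Y : Finset V) (o : V → Finset V)
    (p : V → ℕ) (t : ℕ) (ht : 1 ≤ t) (hAR : A ⊆ R) (hBR : B ⊆ R) (hAB : Disjoint A B)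
    (hAind : ∀ u ∈ A, ∀ v ∈ A, ¬ G.Adj u v)
    (hYind : ∀ u ∈ Y, ∀ v ∈ Y, ¬ G.Adj u v)
    (ho : ∀ u v, v ∈ o u → G.Adj u v)
    (hA1 : ∀ a ∈ A, p a + (o a ∩ R).card ≤ t) (hA2 : ∀ a ∈ A, t ≤ qq G R p a)
    (hB : ∀ b ∈ B, qq G R p b = t) :
    ∃ (S I U : Finset V) (p' : V → ℕ),
      (Sol G (R \ S) p' (t - 1) → Sol G R p t) ∧ S ⊆ R ∧ I ⊆ S ∧ I ⊆ U ∧ U ⊆ B ∧ Y ∩ U ⊆ I ∧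
      (∀ v ∈ R \ S, qq G (R \ S) p' v ≤ qq G R p v) ∧
      (∀ b ∈ B, b ∉ S → qq G (R \ S) p' b < t) ∧
      (∀ a ∈ A, a ∉ S → t < p a + (o a ∩ R).card + (nb G U a).card ∧ 1 ≤ (nb G I a).card ∧
        qq G (R \ S) p' a + (nb G I a).card ≤ qq G R p a) ∧
      (∀ v ∈ R \ S, (∀ a ∈ A, ¬ G.Adj v a) → p' v = p v) ∧
      ((∀ u ∈ R, ∀ v ∈ R, G.Adj u v → v ∈ o u ∨ u ∈ o v) →
        ∀ v ∈ R \ S, p' v + (o v ∩ (R \ S)).card ≤ p v + (o v ∩ R).card) := by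
  obtain ⟨C, own0, hCA, hC1, hC2, hC3⟩ := max_cov G R A B o p t hBR ho hA2
  set U := B.filter (fun b => ∀ c ∈ C, ¬ G.Adj c b) with hU
  obtain ⟨I, hIU, hYI, hIind, hImax⟩ := max_indep G U (Y ∩ U) Finset.inter_subset_right
    (fun u hu v hv => hYind u (Finset.mem_inter.1 hu).1 v (Finset.mem_inter.1 hv).1)
  have hUB : U ⊆ B := Finset.filter_subset _ _
  have hex : ∀ a : V, ∃ W : Finset V, a ∈ A →
      o a ∩ R ⊆ W ∧ W ⊆ nb G R a ∧ p a + W.card = t := by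
    intro a
    by_cases ha : a ∈ A
    · have hq := hA2 a ha
      have h1 := hA1 a ha
      unfold qq at hq
      obtain ⟨W, hW1, hW2, hW3⟩ := Finset.exists_subsuperset_card_eq (n := t - p a)
        (s := o a ∩ R) (t := nb G R a)
        (by
          intro x hx
          rw [Finset.mem_inter] at hx
          exact mem_nb.2 ⟨hx.2, ho _ _ hx.1⟩) (by omega) (by omega)
      exact ⟨W, fun _ => ⟨hW1, hW2, by omega⟩⟩
    · exact ⟨∅, fun h => absurd h ha⟩
  choose own1 hown1 using hex
  set Z := A.filter (fun a => a ∉ C ∧ ∀ i ∈ I, ¬ G.Adj a i) with hZ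
  obtain ⟨own, hownC, hownA, hownN⟩ : ∃ own : V → Finset V, (∀ v ∈ C, own v = own0 v) ∧
      (∀ v ∈ A, v ∉ C → own v = own1 v) ∧ (∀ v, v ∉ A → own v = nb G R v) :=
    ⟨fun v => if v ∈ C then own0 v else if v ∈ A then own1 v else nb G R v,
      fun v hv => by simp [hv], fun v hv hv2 => by simp [hv, hv2],
      fun v hv => by
        have hvC : v ∉ C := fun h => hv (hCA h)
        simp [hv, hvC]⟩
  have hBA : ∀ b ∈ B, b ∉ A := fun b hb hb2 => Finset.disjoint_left.1 hAB hb2 hb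
  have hownI : ∀ i ∈ I, own i = nb G R i := fun i hi => hownN i (hBA i (hUB (hIU hi)))
  have hZA : Z ⊆ A := Finset.filter_subset _ _
  have hCZ : ∀ v ∈ C ∪ Z, v ∈ A ∧ o v ∩ R ⊆ own v ∧ own v ⊆ nb G R v ∧
      p v + (own v).card = t := by
    intro v hv
    rw [Finset.mem_union] at hv
    rcases hv with hv | hv
    · rw [hownC v hv]
      exact ⟨hCA hv, hC1 v hv⟩
    · rw [hownA v (hZA hv) (Finset.mem_filter.1 hv).2.1]
      exact ⟨hZA hv, hown1 v (hZA hv)⟩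
  have hCI : ∀ v ∈ C ∪ Z, ∀ i ∈ I, ¬ G.Adj v i := by
    intro v hv i hi
    rw [Finset.mem_union] at hv
    rcases hv with hv | hv
    · exact (Finset.mem_filter.1 (hIU hi)).2 v hv
    · exact (Finset.mem_filter.1 hv).2.2 i hi
  obtain ⟨S, hS⟩ : ∃ S, S = (C ∪ Z) ∪ I := ⟨_, rfl⟩
  have memS : ∀ v, v ∈ S ↔ v ∈ C ∪ Z ∨ v ∈ I := fun v => by rw [hS, Finset.mem_union]
  have hIR : I ⊆ R := (hIU.trans hUB).trans hBR
  have hSR : S ⊆ R := by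
    intro v hv
    rcases (memS v).1 hv with h | h
    · exact hAR (hCZ v h).1
    · exact hIR h
  have hIS : I ⊆ S := fun v hv => (memS v).2 (Or.inr hv)
  have hCS : C ⊆ S := fun v hv => (memS v).2 (Or.inl (Finset.mem_union_left _ hv))
  have hZS : Z ⊆ S := fun v hv => (memS v).2 (Or.inl (Finset.mem_union_right _ hv))
  have hqn := qq_new G R S own p hSR
  refine ⟨S, I, U, pnew G S own p, ?_, hSR, hIS, hIU, hUB, hYI, ?_, ?_, ?_, ?_, ?_⟩
  · apply ext_lemma G R S own p t ht hSR
    · intro u hu v hv huv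
      rcases (memS u).1 hu with hu | hu <;> rcases (memS v).1 hv with hv | hv
      · exact hAind u (hCZ u hu).1 v (hCZ v hv).1 huv
      · exact hCI u hu v hv huv
      · exact hCI v hv u hu huv.symm
      · exact hIind u hu v hv huv
    · intro s hs
      rcases (memS s).1 hs with hs | hs
      · exact (hCZ s hs).2.2
      · rw [hownI s hs]
        exact ⟨subset_rfl, hB s (hUB (hIU hs))⟩
  · intro v _
    have := hqn v
    omega
  · intro b hb hbS
    have hpos : 0 < (S.filter (fun s => G.Adj b s ∧ b ∈ own s)).card := by
      rw [Finset.card_pos]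
      by_cases hbC : ∃ a ∈ C, G.Adj a b
      · obtain ⟨a, ha, hab⟩ := hbC
        obtain ⟨a', ha', hba'⟩ := hC2 b hb a ha hab
        refine ⟨a', Finset.mem_filter.2 ⟨hCS ha', ?_, ?_⟩⟩
        · exact (mem_nb.1 ((hC1 a' ha').2.1 hba')).2.symm
        · rw [hownC a' ha']; exact hba'
      · push Not at hbC
        obtain ⟨i, hi, hbi⟩ := hImax b (Finset.mem_filter.2 ⟨hb, hbC⟩) (fun h => hbS (hIS h))
        refine ⟨i, Finset.mem_filter.2 ⟨hIS hi, hbi, ?_⟩⟩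
        rw [hownI i hi]
        exact mem_nb.2 ⟨hBR hb, hbi.symm⟩
    have := hqn b
    have := hB b hb
    omega
  · intro a ha haS
    have haC : a ∉ C := fun h => haS (hCS h)
    refine ⟨hC3 a ha haC, ?_, ?_⟩
    · by_contra hlt
      have he : nb G I a = ∅ := Finset.card_eq_zero.1 (by omega)
      apply haS
      apply hZS
      refine Finset.mem_filter.2 ⟨ha, haC, ?_⟩
      intro i hi hai
      have : i ∈ nb G I a := mem_nb.2 ⟨hi, hai⟩
      rw [he] at this
      simp at this
    · have hle : (nb G I a).card ≤ (S.filter (fun s => G.Adj a s ∧ a ∈ own s)).card := by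
        apply Finset.card_le_card
        intro i hi
        rw [mem_nb] at hi
        refine Finset.mem_filter.2 ⟨hIS hi.1, hi.2, ?_⟩
        rw [hownI i hi.1]
        exact mem_nb.2 ⟨hAR ha, hi.2.symm⟩
      have := hqn a
      omega
  · intro v hv hno
    unfold pnew
    rw [Nat.add_eq_left, Finset.card_eq_zero, Finset.filter_eq_empty_iff]
    rintro s hs ⟨h1, h2⟩
    rcases (memS s).1 hs with hs | hs
    · exact hno s (hCZ s hs).1 h1
    · rw [hownI s hs] at h2
      exact h2 (mem_nb.2 ⟨(Finset.mem_sdiff.1 hv).1, h1.symm⟩)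
  · intro hor v hv
    have hvR := (Finset.mem_sdiff.1 hv).1
    have : (S.filter (fun s => G.Adj v s ∧ v ∉ own s)) ∪ (o v ∩ (R \ S)) ⊆ o v ∩ R := by
      intro s hs
      rw [Finset.mem_union, Finset.mem_filter, Finset.mem_inter, Finset.mem_sdiff] at hs
      rw [Finset.mem_inter]
      rcases hs with ⟨hs, h1, h2⟩ | hs
      · refine ⟨?_, hSR hs⟩
        rcases (memS s).1 hs with hs' | hs'
        · rcases hor v hvR s (hSR hs) h1 with h | h
          · exact h
          · exact absurd ((hCZ s hs').2.1 (Finset.mem_inter.2 ⟨h, hvR⟩)) h2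
        · rw [hownI s hs'] at h2
          exact absurd (mem_nb.2 ⟨hvR, h1.symm⟩) h2
      · exact ⟨hs.1, hs.2.1⟩
    have hcard := Finset.card_le_card this
    rw [Finset.card_union_of_disjoint] at hcard
    · unfold pnew; omega
    · rw [Finset.disjoint_left]
      intro s hs hs2
      rw [Finset.mem_filter] at hs
      rw [Finset.mem_inter, Finset.mem_sdiff] at hs2
      exact hs2.2.2 hs.1

lemma peel {V : Type*} (G : SimpleGraph V) (t : ℕ) : ∀ (R : Finset V) (p : V → ℕ),
    (∀ v ∈ R, qq G R p v ≤ t) → Sol G R p t := by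
  induction t with
  | zero =>
    intro R p h
    have hno : ∀ u ∈ R, ∀ v ∈ R, ¬ G.Adj u v := by
      intro u hu v hv huv
      have h1 := h u hu
      unfold qq at h1
      have : nb G R u = ∅ := Finset.card_eq_zero.1 (by omega)
      have h2 : v ∈ nb G R u := mem_nb.2 ⟨hv, huv⟩
      rw [this] at h2
      simp at h2
    refine ⟨fun _ _ => False, fun u hu v hv huv => absurd huv (hno u hu v hv),
      fun _ _ h => h.elim, fun _ _ h => h.elim, ?_,
      fun u hu v hv huv => absurd huv (hno u hu v hv)⟩
    intro u hu
    have h1 := h u hu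
    unfold qq at h1
    simp
    omega
  | succ t ih =>
    intro R p h
    obtain ⟨S, I, U, p', h1, hSR, hIS, hIU, hUB, hYI, h2, h3, h4, h5, h6⟩ :=
      level G R ∅ (R.filter (fun v => qq G R p v = t + 1)) ∅ (fun _ => ∅) p (t + 1) (by omega)
        (by simp) (Finset.filter_subset _ _) (by simp) (by simp) (by simp) (by simp) (by simp)
        (by simp) (fun b hb => (Finset.mem_filter.1 hb).2)
    apply h1
    apply ih
    intro v hv
    have hvR := Finset.mem_sdiff.1 hv
    by_cases hq : qq G R p v = t + 1
    · have := h3 v (Finset.mem_filter.2 ⟨hvR.1, hq⟩) hvR.2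
      omega
    · have := h2 v hv
      have := h v hvR.1
      omega

lemma stage5 {V : Type*} (G : SimpleGraph V) (c : V → Fin 3) (R : Finset V) (p : V → ℕ)
    (hc : ∀ u ∈ R, ∀ v ∈ R, G.Adj u v → c u ≠ c v)
    (h02 : ∀ v ∈ R, c v ≠ 1 → qq G R p v ≤ 5)
    (h1 : ∀ v ∈ R, c v = 1 → p v ≤ 2 ∧ (qq G R p v ≤ 5 ∨
      qq G R p v + (nb G (R.filter (fun x => c x = 2)) v).card + p v ≤ 10)) :
    Sol G R p 5 := by
  obtain ⟨S, I, U, p', s1, hSR, hIS, hIU, hUB, hYI, s2, s3, s4, s5, s6⟩ :=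
    level G R (R.filter (fun v => c v = 1 ∧ 5 ≤ qq G R p v))
      (R.filter (fun v => c v ≠ 1 ∧ qq G R p v = 5))
      (R.filter (fun v => c v = 0 ∧ qq G R p v = 5)) (fun _ => ∅) p 5 (by omega)
      (Finset.filter_subset _ _) (Finset.filter_subset _ _)
      (by
        rw [Finset.disjoint_left]
        intro v hv hv2
        exact (Finset.mem_filter.1 hv2).2.1 (Finset.mem_filter.1 hv).2.1)
      (by
        intro u hu v hv huv
        rw [Finset.mem_filter] at hu hv
        exact hc u hu.1 v hv.1 huv (hu.2.1.trans hv.2.1.symm))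
      (by
        intro u hu v hv huv
        rw [Finset.mem_filter] at hu hv
        exact hc u hu.1 v hv.1 huv (hu.2.1.trans hv.2.1.symm))
      (by simp)
      (by
        intro a ha
        rw [Finset.mem_filter] at ha
        have := (h1 a ha.1 ha.2.1).1
        simp
        omega)
      (fun a ha => (Finset.mem_filter.1 ha).2.2)
      (fun a ha => (Finset.mem_filter.1 ha).2.2)
  apply s1
  apply peel
  intro v hv
  obtain ⟨hvR, hvS⟩ := Finset.mem_sdiff.1 hv
  have hle := s2 v hv
  by_cases hcv : c v = 1
  · by_cases hq : 5 ≤ qq G R p v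
    · obtain ⟨a1, a2, a3⟩ := s4 v (Finset.mem_filter.2 ⟨hvR, hcv, hq⟩) hvS
      obtain ⟨b1, b2⟩ := h1 v hvR hcv
      have e1 : (nb G U v).card ≤ (nb G R v).card := by
        apply Finset.card_le_card
        intro x hx
        rw [mem_nb] at hx ⊢
        exact ⟨(Finset.mem_filter.1 (hUB hx.1)).1, hx.2⟩
      have e2 : nb G U v ⊆ nb G I v ∪ nb G (R.filter (fun x => c x = 2)) v := by
        intro x hx
        rw [Finset.mem_union]
        rw [mem_nb] at hx
        have hxB := Finset.mem_filter.1 (hUB hx.1)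
        by_cases h0 : c x = 0
        · left
          rw [mem_nb]
          exact ⟨hYI (Finset.mem_inter.2 ⟨Finset.mem_filter.2 ⟨hxB.1, h0, hxB.2.2⟩, hx.1⟩), hx.2⟩
        · right
          rw [mem_nb, Finset.mem_filter]
          refine ⟨⟨hxB.1, ?_⟩, hx.2⟩
          have := hxB.2.1
          revert h0 this
          generalize c x = y
          revert y
          decide
      have e3 := (Finset.card_le_card e2).trans (Finset.card_union_le _ _)
      simp only [Finset.empty_inter, Finset.card_empty] at a1
      have e4 : qq G R p v = p v + (nb G R v).card := rfl
      omega
    · omega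
  · have hb := h02 v hvR hcv
    by_cases hq : qq G R p v = 5
    · have := s3 v (Finset.mem_filter.2 ⟨hvR, hcv, hq⟩) hvS
      omega
    · omega

lemma stage6 {V : Type*} (G : SimpleGraph V) (c : V → Fin 3) (R : Finset V) (p : V → ℕ)
    (hc : ∀ u ∈ R, ∀ v ∈ R, G.Adj u v → c u ≠ c v)
    (h02 : ∀ v ∈ R, c v ≠ 1 → qq G R p v ≤ 6)
    (h1 : ∀ v ∈ R, c v = 1 → p v ≤ 2 ∧ qq G R p v ≤ 8) :
    Sol G R p 6 := by
  obtain ⟨S, I, U, p', s1, hSR, hIS, hIU, hUB, hYI, s2, s3, s4, s5, s6⟩ :=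
    level G R (R.filter (fun v => c v = 1 ∧ 6 ≤ qq G R p v))
      (R.filter (fun v => c v ≠ 1 ∧ qq G R p v = 6))
      (R.filter (fun v => c v = 2 ∧ qq G R p v = 6)) (fun _ => ∅) p 6 (by omega)
      (Finset.filter_subset _ _) (Finset.filter_subset _ _)
      (by
        rw [Finset.disjoint_left]
        intro v hv hv2
        exact (Finset.mem_filter.1 hv2).2.1 (Finset.mem_filter.1 hv).2.1)
      (by
        intro u hu v hv huv
        rw [Finset.mem_filter] at hu hv
        exact hc u hu.1 v hv.1 huv (hu.2.1.trans hv.2.1.symm))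
      (by
        intro u hu v hv huv
        rw [Finset.mem_filter] at hu hv
        exact hc u hu.1 v hv.1 huv (hu.2.1.trans hv.2.1.symm))
      (by simp)
      (by
        intro a ha
        rw [Finset.mem_filter] at ha
        have := (h1 a ha.1 ha.2.1).1
        simp
        omega)
      (fun a ha => (Finset.mem_filter.1 ha).2.2)
      (fun a ha => (Finset.mem_filter.1 ha).2.2)
  apply s1
  apply stage5 G c
  · intro u hu v hv
    exact hc u (Finset.mem_sdiff.1 hu).1 v (Finset.mem_sdiff.1 hv).1
  · intro v hv hcv
    obtain ⟨hvR, hvS⟩ := Finset.mem_sdiff.1 hv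
    have hle := s2 v hv
    have hb := h02 v hvR hcv
    by_cases hq : qq G R p v = 6
    · have := s3 v (Finset.mem_filter.2 ⟨hvR, hcv, hq⟩) hvS
      omega
    · omega
  · intro v hv hcv
    obtain ⟨hvR, hvS⟩ := Finset.mem_sdiff.1 hv
    have hle := s2 v hv
    obtain ⟨b1, b2⟩ := h1 v hvR hcv
    have hp : p' v = p v := by
      apply s5 v hv
      intro a ha hva
      rw [Finset.mem_filter] at ha
      exact hc v hvR a ha.1 hva (hcv.trans ha.2.1.symm)
    rw [hp]
    refine ⟨b1, ?_⟩
    by_cases hq : 6 ≤ qq G R p v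
    · right
      obtain ⟨a1, a2, a3⟩ := s4 v (Finset.mem_filter.2 ⟨hvR, hcv, hq⟩) hvS
      have e1 : nb G ((R \ S).filter (fun x => c x = 2)) v ∪ nb G U v ⊆ nb G R v := by
        intro x hx
        rw [Finset.mem_union, mem_nb, mem_nb] at hx
        rw [mem_nb]
        rcases hx with hx | hx
        · exact ⟨(Finset.mem_sdiff.1 (Finset.mem_filter.1 hx.1).1).1, hx.2⟩
        · exact ⟨(Finset.mem_filter.1 (hUB hx.1)).1, hx.2⟩
      have e2 := Finset.card_le_card e1
      rw [Finset.card_union_of_disjoint] at e2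
      · simp only [Finset.empty_inter, Finset.card_empty] at a1
        have e4 : qq G R p v = p v + (nb G R v).card := rfl
        omega
      · rw [Finset.disjoint_left]
        intro x hx hx2
        rw [mem_nb, Finset.mem_filter, Finset.mem_sdiff] at hx
        rw [mem_nb] at hx2
        have hxB := Finset.mem_filter.1 (hUB hx2.1)
        exact hx.1.1.2 (hIS (hYI (Finset.mem_inter.2
          ⟨Finset.mem_filter.2 ⟨hxB.1, hx.1.2, hxB.2.2⟩, hx2.1⟩)))
    · left
      omega

lemma stage7 {V : Type*} (G : SimpleGraph V) (c : V → Fin 3) (o : V → Finset V)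
    (ho : ∀ u v, v ∈ o u → G.Adj u v) (R : Finset V) (p : V → ℕ)
    (hc : ∀ u ∈ R, ∀ v ∈ R, G.Adj u v → c u ≠ c v)
    (hor : ∀ u ∈ R, ∀ v ∈ R, G.Adj u v → v ∈ o u ∨ u ∈ o v)
    (hp : ∀ v ∈ R, p v + (o v ∩ R).card ≤ 2)
    (h0 : ∀ v ∈ R, c v = 0 → qq G R p v ≤ 9)
    (h1 : ∀ v ∈ R, c v = 1 → qq G R p v ≤ 8)
    (h2 : ∀ v ∈ R, c v = 2 → qq G R p v ≤ 7) :
    Sol G R p 7 := by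
  obtain ⟨S, I, U, p', s1, hSR, hIS, hIU, hUB, hYI, s2, s3, s4, s5, s6⟩ :=
    level G R (R.filter (fun v => c v = 0 ∧ 7 ≤ qq G R p v))
      (R.filter (fun v => c v = 2 ∧ qq G R p v = 7))
      (R.filter (fun v => c v = 2 ∧ qq G R p v = 7)) o p 7 (by omega)
      (Finset.filter_subset _ _) (Finset.filter_subset _ _)
      (by
        rw [Finset.disjoint_left]
        intro v hv hv2
        have e1 := (Finset.mem_filter.1 hv2).2.1
        rw [(Finset.mem_filter.1 hv).2.1] at e1
        exact absurd e1 (by decide))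
      (by
        intro u hu v hv huv
        rw [Finset.mem_filter] at hu hv
        exact hc u hu.1 v hv.1 huv (hu.2.1.trans hv.2.1.symm))
      (by
        intro u hu v hv huv
        rw [Finset.mem_filter] at hu hv
        exact hc u hu.1 v hv.1 huv (hu.2.1.trans hv.2.1.symm))
      ho
      (by
        intro a ha
        rw [Finset.mem_filter] at ha
        have := hp a ha.1
        omega)
      (fun a ha => (Finset.mem_filter.1 ha).2.2)
      (fun a ha => (Finset.mem_filter.1 ha).2.2)
  apply s1
  apply stage6 G c
  · intro u hu v hv
    exact hc u (Finset.mem_sdiff.1 hu).1 v (Finset.mem_sdiff.1 hv).1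
  · intro v hv hcv
    obtain ⟨hvR, hvS⟩ := Finset.mem_sdiff.1 hv
    have hle := s2 v hv
    have hcases : c v = 0 ∨ c v = 2 := by
      revert hcv
      generalize c v = y
      revert y
      decide
    rcases hcases with hcv | hcv
    · by_cases hq : 7 ≤ qq G R p v
      · obtain ⟨a1, a2, a3⟩ := s4 v (Finset.mem_filter.2 ⟨hvR, hcv, hq⟩) hvS
        have e1 : (nb G U v).card ≤ (nb G I v).card := by
          apply Finset.card_le_card
          intro x hx
          rw [mem_nb] at hx ⊢
          exact ⟨hYI (Finset.mem_inter.2 ⟨hUB hx.1, hx.1⟩), hx.2⟩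
        have := hp v hvR
        have := h0 v hvR hcv
        omega
      · omega
    · have hb := h2 v hvR hcv
      by_cases hq : qq G R p v = 7
      · have := s3 v (Finset.mem_filter.2 ⟨hvR, hcv, hq⟩) hvS
        omega
      · omega
  · intro v hv hcv
    obtain ⟨hvR, hvS⟩ := Finset.mem_sdiff.1 hv
    have hle := s2 v hv
    have := h1 v hvR hcv
    have := s6 hor v hv
    have := hp v hvR
    omega

lemma top_stage {V : Type*} (G : SimpleGraph V) (c : V → Fin 3) (o : V → Finset V)
    (ho : ∀ u v, v ∈ o u → G.Adj u v) (R : Finset V) (p : V → ℕ) (t : ℕ) (ht : 3 ≤ t) (k : Fin 3)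
    (hc : ∀ u ∈ R, ∀ v ∈ R, G.Adj u v → c u ≠ c v)
    (hor : ∀ u ∈ R, ∀ v ∈ R, G.Adj u v → v ∈ o u ∨ u ∈ o v)
    (hp : ∀ v ∈ R, p v + (o v ∩ R).card ≤ 2) :
    ∃ (R' : Finset V) (p' : V → ℕ), R' ⊆ R ∧ (Sol G R' p' (t - 1) → Sol G R p t) ∧
      (∀ v ∈ R', p' v + (o v ∩ R').card ≤ 2) ∧ (∀ v ∈ R', qq G R' p' v ≤ qq G R p v) ∧
      (∀ v ∈ R', c v = k → qq G R' p' v ≤ t - 1) := by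
  obtain ⟨S, I, U, p', s1, hSR, hIS, hIU, hUB, hYI, s2, s3, s4, s5, s6⟩ :=
    level G R (R.filter (fun v => c v = k ∧ t ≤ qq G R p v)) ∅ ∅ o p t (by omega)
      (Finset.filter_subset _ _) (by simp) (by simp)
      (by
        intro u hu v hv huv
        rw [Finset.mem_filter] at hu hv
        exact hc u hu.1 v hv.1 huv (hu.2.1.trans hv.2.1.symm))
      (by simp) ho
      (by
        intro a ha
        rw [Finset.mem_filter] at ha
        have := hp a ha.1
        omega)
      (fun a ha => (Finset.mem_filter.1 ha).2.2)
      (by simp)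
  refine ⟨R \ S, p', Finset.sdiff_subset, s1, ?_, s2, ?_⟩
  · intro v hv
    exact (s6 hor v hv).trans (hp v (Finset.mem_sdiff.1 hv).1)
  · intro v hv hcv
    obtain ⟨hvR, hvS⟩ := Finset.mem_sdiff.1 hv
    have hle := s2 v hv
    by_cases hq : t ≤ qq G R p v
    · obtain ⟨a1, a2, a3⟩ := s4 v (Finset.mem_filter.2 ⟨hvR, hcv, hq⟩) hvS
      have hI : I = ∅ := Finset.subset_empty.1 (hIU.trans hUB)
      rw [hI] at a2
      simp [nb] at a2
    · omega

lemma sol10 {V : Type*} (G : SimpleGraph V) (c : V → Fin 3) (o : V → Finset V)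
    (ho : ∀ u v, v ∈ o u → G.Adj u v) (R : Finset V)
    (hc : ∀ u ∈ R, ∀ v ∈ R, G.Adj u v → c u ≠ c v)
    (hor : ∀ u ∈ R, ∀ v ∈ R, G.Adj u v → v ∈ o u ∨ u ∈ o v)
    (hp : ∀ v, (o v).card ≤ 2) : Sol G R (fun _ => 0) 10 := by
  obtain ⟨R1, p1, hR1, a1, a2, a3, a4⟩ := top_stage G c o ho R (fun _ => 0) 10 (by omega) 0 hc hor
    (fun v _ => by
      have := Finset.card_le_card (Finset.inter_subset_left : o v ∩ R ⊆ o v)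
      have := hp v
      omega)
  have hc1 : ∀ u ∈ R1, ∀ v ∈ R1, G.Adj u v → c u ≠ c v :=
    fun u hu v hv => hc u (hR1 hu) v (hR1 hv)
  have hor1 : ∀ u ∈ R1, ∀ v ∈ R1, G.Adj u v → v ∈ o u ∨ u ∈ o v :=
    fun u hu v hv => hor u (hR1 hu) v (hR1 hv)
  obtain ⟨R2, p2, hR2, b1, b2, b3, b4⟩ := top_stage G c o ho R1 p1 9 (by omega) 1 hc1 hor1 a2
  have hc2 : ∀ u ∈ R2, ∀ v ∈ R2, G.Adj u v → c u ≠ c v :=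
    fun u hu v hv => hc1 u (hR2 hu) v (hR2 hv)
  have hor2 : ∀ u ∈ R2, ∀ v ∈ R2, G.Adj u v → v ∈ o u ∨ u ∈ o v :=
    fun u hu v hv => hor1 u (hR2 hu) v (hR2 hv)
  obtain ⟨R3, p3, hR3, c1, c2, c3, c4⟩ := top_stage G c o ho R2 p2 8 (by omega) 2 hc2 hor2 b2
  apply a1
  apply b1
  apply c1
  apply stage7 G c o ho R3 p3
  · exact fun u hu v hv => hc2 u (hR3 hu) v (hR3 hv)
  · exact fun u hu v hv => hor2 u (hR3 hu) v (hR3 hv)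
  · exact c2
  · intro v hv hcv
    have e1 := c3 v hv
    have e2 := b3 v (hR3 hv)
    have e3 := a4 v (hR2 (hR3 hv)) hcv
    omega
  · intro v hv hcv
    have e1 := c3 v hv
    have e2 := b4 v (hR3 hv) hcv
    omega
  · intro v hv hcv
    have e1 := c4 v hv hcv
    omega

lemma final {V : Type*} [Fintype V] (G : SimpleGraph V)
    (hG : ¬ HasMinor G (completeGraph (Fin 4))) :
    ∃ o : GOrientation G, o.IsProper ∧ ∀ u, o.outDeg u ≤ 10 := by
  obtain ⟨c, o, hc, hor, ho, hcard⟩ := degen G hG Finset.univ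
  obtain ⟨d, h1, h2, h3, h4, h5⟩ := sol10 G c o ho Finset.univ hc hor hcard
  let O : GOrientation G :=
    { dir := fun u v => decide (d u v)
      adj_iff := by
        intro u v
        simp only [decide_eq_true_eq]
        constructor
        · exact h1 u (Finset.mem_univ _) v (Finset.mem_univ _)
        · rintro (h | h)
          · exact h2 u v h
          · exact (h2 v u h).symm
      not_both := by
        intro u v
        simp only [decide_eq_true_eq]
        rintro ⟨h, h'⟩
        exact h3 u v h h' }
  have hout : ∀ u, O.outDeg u = 0 + (Finset.univ.filter (fun v => d u v)).card := by
    intro u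
    rw [Nat.zero_add]
    unfold GOrientation.outDeg
    congr 1
    ext v
    simp [O]
  refine ⟨O, ?_, ?_⟩
  · intro u v huv
    rw [hout, hout]
    exact h5 u (Finset.mem_univ _) v (Finset.mem_univ _) huv
  · intro u
    rw [hout]
    exact h4 u (Finset.mem_univ _)

end Orient

theorem stmt15 {V : Type*} [Fintype V] (G : SimpleGraph V)
    (hG : ¬ HasMinor G (completeGraph (Fin 4))) :
    ∃ o : GOrientation G, o.IsProper ∧ ∀ u, o.outDeg u ≤ 10 := by
  exact final G hG
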